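/- arXiv:2302.07858 — 2 statements merged into one kernel-verified Lean document; each statement's English description precedes it below -/
import Mathlib

section
/- Let F : ℕ → ℤ satisfy F 0 = 0, F 1 = 1, F (n+2) = -2 F (n+1) + 2 F n. Then for all n, as real numbers: F(n+2) * F(n) = (2^n / 6) * ((2+√3)^{n+1} + (2-√3)^{n+1} + 4*(-1)^{n+1}). -/
/-- Binet's formula for `F (n + 2) = -2 * F (n + 1) + 2 * F n`. -/
theorem two_mul_sqrt_three_mul_eq_pow_sub_pow (F : ℕ → ℤ) (h0 : F 0 = 0) (h1 : F 1 = 1)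
    (hrec : ∀ n, F (n+2) = -2 * F (n+1) + 2 * F n) (n : ℕ) :
    2 * Real.sqrt 3 * (F n : ℝ) = (-1 + Real.sqrt 3) ^ n - (-1 - Real.sqrt 3) ^ n := by
  have hs : Real.sqrt 3 ^ 2 = 3 := Real.sq_sqrt (by norm_num)
  induction n using Nat.twoStepInduction with
  | zero => simp [h0]
  | one => simp [h1]; ring
  | more n ih ih' =>
    rw [hrec n]
    push_cast
    linear_combination (-2) * ih' + 2 * ih
      - ((-1 + Real.sqrt 3) ^ n - (-1 - Real.sqrt 3) ^ n) * hs

theorem stmt_6 (F : ℕ → ℤ) (h0 : F 0 = 0) (h1 : F 1 = 1)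
    (hrec : ∀ n, F (n+2) = -2 * F (n+1) + 2 * F n) :
    ∀ n : ℕ, ((F (n+2) : ℝ)) * (F n : ℝ) =
      (2^n / 6) * ((2 + Real.sqrt 3)^(n+1) + (2 - Real.sqrt 3)^(n+1) + 4 * (-1)^(n+1)) := by
  intro n
  have hs : Real.sqrt 3 ^ 2 = 3 := Real.sq_sqrt (by norm_num)
  have hn := two_mul_sqrt_three_mul_eq_pow_sub_pow F h0 h1 hrec n
  have hn2 := two_mul_sqrt_three_mul_eq_pow_sub_pow F h0 h1 hrec (n + 2)
  have hprod : 12 * ((F (n+2) : ℝ) * (F n : ℝ)) =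
      ((-1 + Real.sqrt 3) ^ (n + 2) - (-1 - Real.sqrt 3) ^ (n + 2)) *
        ((-1 + Real.sqrt 3) ^ n - (-1 - Real.sqrt 3) ^ n) := by
    rw [← hn, ← hn2]
    linear_combination (-4 * (F (n+2) : ℝ) * (F n : ℝ)) * hs
  have ha : (-1 + Real.sqrt 3) ^ 2 = 2 * (2 - Real.sqrt 3) := by linear_combination hs
  have hb : (-1 - Real.sqrt 3) ^ 2 = 2 * (2 + Real.sqrt 3) := by linear_combination hs
  have hab : (-1 + Real.sqrt 3) * (-1 - Real.sqrt 3) = 2 * (-1) := by linear_combination -hs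
  have hA := congrArg (· ^ (n + 1)) ha
  have hB := congrArg (· ^ (n + 1)) hb
  have hAB := congrArg (· ^ n) hab
  simp only [mul_pow] at hA hB hAB
  generalize -1 + Real.sqrt 3 = a at *
  generalize -1 - Real.sqrt 3 = b at *
  linear_combination hprod / 12 + hA / 12 + hB / 12 - (a ^ 2 + b ^ 2) / 12 * hAB
    - 2 ^ n * (-1) ^ n / 12 * (ha + hb)
end

section
/- Let F : ℕ → ℤ satisfy F 0 = 0, F 1 = 1, F (n+2) = -2 F (n+1) + 2 F n, and define A_n = F(n+1)^2 - 2 F(n+1) F(n) - 2 F(n)^2 ∈ ℤ. Then 2^n divides A_n for every n, and the Gaussian integers a_n = A_n / 2^n, b_n = (i F(n+1)^2 + 2 F(n+1) F(n) + 2 i F(n)^2)/2^n, c_n = (i F(n+1)^2 - 2 F(n+1) F(n) + 2 i F(n)^2)/2^n are Gaussian integers satisfying a_n^5 + b_n^5 = c_n^5 + (-1)^n. -/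
/-- The products `F n * F (n+1)` and `2 * F n ^ 2` are divisible by `2 ^ n`, and the norm form
`x ^ 2 + 2 x y - 2 y ^ 2` of consecutive terms equals `(-2) ^ n`. -/
theorem exists_quotients_of_recurrence (F : ℕ → ℤ) (h0 : F 0 = 0) (h1 : F 1 = 1)
    (hrec : ∀ n, F (n+2) = -2 * F (n+1) + 2 * F n) (n : ℕ) :
    ∃ p u : ℤ, F (n+1) * F n = 2^n * p ∧ 2 * F n^2 = 2^n * u ∧
      F (n+1)^2 = 2^n * ((-1)^n - 2 * p + u) := by
  induction n with
  | zero => exact ⟨0, 0, by simp [h0, h1]⟩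
  | succ n ih =>
    obtain ⟨p, u, hp, hu, hx⟩ := ih
    refine ⟨3 * p - (-1)^n - u, (-1)^n - 2 * p + u, ?_, ?_, ?_⟩
    · rw [hrec]
      linear_combination 2 * hp - 2 * hx
    · linear_combination 2 * hx
    · rw [hrec]
      linear_combination 4 * hx - 8 * hp + 2 * hu

/-- The quintic identity behind the near-miss `a ^ 5 + b ^ 5 = c ^ 5 ± 1`, in an arbitrary commutative ring. -/
theorem pow_five_add_pow_five_of_sq_eq {R : Type*} [CommRing R] {e p z : R}
    (hz : z^2 = -(e^2 - 4 * e * p + 12 * p^2)) :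
    (e - 4 * p)^5 + (z + 2 * p)^5 = (z - 2 * p)^5 + e^5 := by
  linear_combination
    (20 * p * (z^2 - (e^2 - 4 * e * p + 12 * p^2)) + 160 * p^3) * hz

theorem stmt_9 (F : ℕ → ℤ) (h0 : F 0 = 0) (h1 : F 1 = 1)
    (hrec : ∀ n, F (n+2) = -2 * F (n+1) + 2 * F n) :
    ∀ n : ℕ, (2^n : ℤ) ∣ (F (n+1)^2 - 2 * F (n+1) * F n - 2 * F n^2) ∧
      ∃ a b c : GaussianInt,
        (2^n : GaussianInt) * a = (F (n+1) : GaussianInt)^2 - 2 * (F (n+1) : GaussianInt) * (F n : GaussianInt) - 2 * (F n : GaussianInt)^2 ∧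
        (2^n : GaussianInt) * b = Zsqrtd.sqrtd * (F (n+1) : GaussianInt)^2 + 2 * (F (n+1) : GaussianInt) * (F n : GaussianInt)
            + 2 * Zsqrtd.sqrtd * (F n : GaussianInt)^2 ∧
        (2^n : GaussianInt) * c = Zsqrtd.sqrtd * (F (n+1) : GaussianInt)^2 - 2 * (F (n+1) : GaussianInt) * (F n : GaussianInt)
            + 2 * Zsqrtd.sqrtd * (F n : GaussianInt)^2 ∧
        a^5 + b^5 = c^5 + (-1)^n := by
  intro n
  obtain ⟨p, u, hp, hu, hx⟩ := exists_quotients_of_recurrence F h0 h1 hrec n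
  have hpu : ((-1)^n - 2 * p + u) * u = 2 * p^2 := by
    have h2 : ((2:ℤ)^n)^2 ≠ 0 := by positivity
    apply mul_left_cancel₀ h2
    linear_combination -(2^n * u) * hx - F (n+1)^2 * hu + 2 * (F (n+1) * F n + 2^n * p) * hp
  have hp' : (F (n+1) : GaussianInt) * F n = 2^n * p := by exact_mod_cast hp
  have hu' : 2 * (F n : GaussianInt)^2 = 2^n * u := by exact_mod_cast hu
  have hx' : (F (n+1) : GaussianInt)^2 = 2^n * ((-1)^n - 2 * p + u) := by exact_mod_cast hx
  have hpu' : ((-1)^n - 2 * p + u) * u = 2 * (p : GaussianInt)^2 := by exact_mod_cast hpu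
  have hI : (Zsqrtd.sqrtd : GaussianInt)^2 = -1 := by
    rw [sq, Zsqrtd.dmuld]
    simp
  have he : ((-1 : GaussianInt)^n)^5 = (-1)^n := by
    rw [← pow_mul, mul_comm, pow_mul]
    norm_num
  refine ⟨⟨(-1)^n - 4 * p, by linear_combination hx - 2 * hp - hu⟩,
    (-1)^n - 4 * p, (Zsqrtd.sqrtd : GaussianInt) * ((-1)^n - 2 * p + 2 * u) + 2 * p,
    (Zsqrtd.sqrtd : GaussianInt) * ((-1)^n - 2 * p + 2 * u) - 2 * p, ?_, ?_, ?_, ?_⟩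
  · linear_combination 2 * hp' + hu' - hx'
  · linear_combination -(Zsqrtd.sqrtd : GaussianInt) * (hx' + hu') - 2 * hp'
  · linear_combination -(Zsqrtd.sqrtd : GaussianInt) * (hx' + hu') + 2 * hp'
  · refine (pow_five_add_pow_five_of_sq_eq ?_).trans (congrArg _ he)
    linear_combination ((-1)^n - 2 * (p : GaussianInt) + 2 * u)^2 * hI - 4 * hpu'
end
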